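/- Let n = 2m with m ≥ 1, and let A be a geodesic of SL(n) with the Hilbert–Schmidt metric. Suppose there are real numbers λ₁,…,λ_m, μ₁,…,μ_m, z₁,…,z_m with z_i ≠ 0 for every i, such that: A(0)ᵀ·A(0) = ⊕_{i=1}^m λ_i·I₂; A(0)ᵀ·A'(0) + A'(0)ᵀ·A(0) = ⊕_{i=1}^m μ_i·I₂; and A(0)ᵀ·A'(0) − A'(0)ᵀ·A(0) = ⊕_{i=1}^m z_i·Z₂. Then the geodesic is bounded: there exists R > 0 with ‖A(t)‖ ≤ R for all t ∈ ℝ. -/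

import Mathlib

noncomputable section
open Matrix Filter

attribute [local instance] Matrix.normedAddCommGroup Matrix.normedSpace

/-- The Hilbert–Schmidt norm of a square real matrix. -/
def hsNorm {ι : Type*} [Fintype ι] (X : Matrix ι ι ℝ) : ℝ :=
  Real.sqrt (Matrix.trace (X * Xᵀ))

/-- A geodesic of `SL(n)` with the Hilbert–Schmidt metric. -/
def IsGeodesic {ι : Type*} [Fintype ι] [DecidableEq ι] (A : ℝ → Matrix ι ι ℝ) : Prop :=
  (∀ t, DifferentiableAt ℝ A t) ∧ (∀ t, DifferentiableAt ℝ (deriv A) t) ∧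
  (∀ t, (A t).det = 1) ∧
  (∀ t, deriv (deriv A) t =
    (Matrix.trace (deriv A t * (A t)⁻¹ * deriv A t * (A t)⁻¹) /
      Matrix.trace ((A t)⁻¹ * ((A t)⁻¹)ᵀ)) • ((A t)⁻¹)ᵀ)

/-- The 2×2 rotation generator `Z₂`. -/
def Z2 : Matrix (Fin 2) (Fin 2) ℝ := !![0, -1; 1, 0]

section MatrixCalculus

variable {ι κ ν : Type*} [Fintype κ] [Fintype ν]

theorem Matrix.hasDerivAt_iff_entry {X : ℝ → Matrix ι κ ℝ} {X' : Matrix ι κ ℝ} {t : ℝ} :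
    HasDerivAt X X' t ↔ ∀ i j, HasDerivAt (fun s => X s i j) (X' i j) t := by
  have h : HasDerivAt X X' t ↔ ∀ i, HasDerivAt (fun s => X s i) (X' i) t :=
    hasDerivAt_pi (φ := fun s i => X s i) (φ' := fun i => X' i)
  exact h.trans (forall_congr' fun i => hasDerivAt_pi)

theorem HasDerivAt.matrix_mul {X : ℝ → Matrix ι κ ℝ} {Y : ℝ → Matrix κ ν ℝ}
    {X' : Matrix ι κ ℝ} {Y' : Matrix κ ν ℝ} {t : ℝ}
    (hX : HasDerivAt X X' t) (hY : HasDerivAt Y Y' t) :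
    HasDerivAt (fun s => X s * Y s) (X' * Y t + X t * Y') t := by
  rw [Matrix.hasDerivAt_iff_entry] at *
  intro i j
  simp only [Matrix.mul_apply, Matrix.add_apply, ← Finset.sum_add_distrib]
  exact HasDerivAt.fun_sum fun k _ => (hX i k).mul (hY k j)

variable [Fintype ι]

theorem HasDerivAt.matrix_transpose {X : ℝ → Matrix ι κ ℝ} {X' : Matrix ι κ ℝ} {t : ℝ}
    (hX : HasDerivAt X X' t) : HasDerivAt (fun s => (X s)ᵀ) X'ᵀ t := by
  rw [Matrix.hasDerivAt_iff_entry] at *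
  exact fun i j => hX j i

theorem HasDerivAt.matrix_trace {X : ℝ → Matrix ι ι ℝ} {X' : Matrix ι ι ℝ} {t : ℝ}
    (hX : HasDerivAt X X' t) : HasDerivAt (fun s => (X s).trace) X'.trace t := by
  rw [Matrix.hasDerivAt_iff_entry] at hX
  exact HasDerivAt.fun_sum fun i _ => hX i i

/-- Jacobi's formula. -/
theorem HasDerivAt.matrix_det [DecidableEq ι] {X : ℝ → Matrix ι ι ℝ} {X' : Matrix ι ι ℝ} {t : ℝ}
    (hX : HasDerivAt X X' t) :
    HasDerivAt (fun s => (X s).det) ((X t).adjugate * X').trace t := by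
  rw [Matrix.hasDerivAt_iff_entry] at hX
  have htr : ((X t).adjugate * X').trace
      = ∑ i, ((X t).updateCol i (fun r => X' r i)).det := by
    refine Finset.sum_congr rfl fun i _ => ?_
    rw [← Matrix.cramer_apply, Matrix.cramer_eq_adjugate_mulVec]
    rfl
  rw [htr]
  simp only [Matrix.det_apply']
  rw [Finset.sum_comm]
  refine HasDerivAt.fun_sum fun σ _ => ?_
  rw [← Finset.mul_sum]
  refine HasDerivAt.const_mul _ ?_
  convert HasDerivAt.fun_finsetProd (u := Finset.univ) (fun i _ => hX (σ i) i) using 1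
  refine Finset.sum_congr rfl fun i _ => ?_
  rw [← Finset.prod_erase_mul _ _ (Finset.mem_univ i), Matrix.updateCol_self, smul_eq_mul]
  congr 1
  refine Finset.prod_congr rfl fun j hj => ?_
  rw [Matrix.updateCol_ne (Finset.ne_of_mem_erase hj)]

theorem Matrix.norm_mul_le_card_mul (M : Matrix ι κ ℝ) (N : Matrix κ ν ℝ) :
    ‖M * N‖ ≤ Fintype.card κ * (‖M‖ * ‖N‖) := by
  refine (Matrix.norm_le_iff (by positivity)).2 fun i j => ?_
  rw [Matrix.mul_apply]
  refine (norm_sum_le _ _).trans ?_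
  rw [← nsmul_eq_mul]
  refine Finset.sum_le_card_nsmul _ _ _ fun k _ => ?_
  rw [norm_mul]
  exact mul_le_mul (M.norm_entry_le_entrywise_sup_norm) (N.norm_entry_le_entrywise_sup_norm)
    (norm_nonneg _) (norm_nonneg _)

end MatrixCalculus

section LinearODE

variable {E : Type*} [NormedAddCommGroup E] [NormedSpace ℝ E]

theorem eq_zero_of_norm_second_deriv_le_of_nonneg {Y V F : ℝ → E} {C : ℝ → ℝ}
    (hY : ∀ t, HasDerivAt Y (V t) t) (hV : ∀ t, HasDerivAt V (F t) t)
    (hC : Continuous C) (hF : ∀ t, ‖F t‖ ≤ C t * ‖Y t‖) (hY0 : Y 0 = 0) (hV0 : V 0 = 0)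
    {t : ℝ} (ht : 0 ≤ t) : Y t = 0 := by
  obtain ⟨K, hK⟩ := (isCompact_Icc (a := (0 : ℝ)) (b := t)).bddAbove_image hC.continuousOn
  have hd : ∀ s, HasDerivAt (fun s => (Y s, V s)) (V s, F s) s := fun s => (hY s).prodMk (hV s)
  have h := norm_le_gronwallBound_of_norm_deriv_right_le (f := fun s => (Y s, V s))
    (f' := fun s => (V s, F s)) (δ := 0) (K := max K 1) (ε := 0) (a := 0) (b := t)
    (fun s _ => (hd s).continuousAt.continuousWithinAt) (fun s _ => (hd s).hasDerivWithinAt)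
    (by simp [hY0, hV0]) (fun s hs => ?_) t ⟨ht, le_rfl⟩
  · rw [gronwallBound_ε0_δ0] at h
    exact norm_le_zero_iff.1 ((le_max_left _ _).trans h)
  · have hCs : C s ≤ K := hK ⟨s, Set.Ico_subset_Icc_self hs, rfl⟩
    have h1 : ‖Y s‖ ≤ ‖(Y s, V s)‖ := norm_fst_le (Y s, V s)
    have h2 : ‖V s‖ ≤ ‖(Y s, V s)‖ := norm_snd_le (Y s, V s)
    have h3 : ‖(Y s, V s)‖ ≤ max K 1 * ‖(Y s, V s)‖ :=
      le_mul_of_one_le_left (norm_nonneg _) (le_max_right _ _)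
    rw [add_zero]
    refine max_le (h2.trans h3) ((hF s).trans ?_)
    exact mul_le_mul (hCs.trans (le_max_left _ _)) h1 (norm_nonneg _) (by positivity)

theorem eq_zero_of_norm_second_deriv_le {Y V F : ℝ → E} {C : ℝ → ℝ}
    (hY : ∀ t, HasDerivAt Y (V t) t) (hV : ∀ t, HasDerivAt V (F t) t)
    (hC : Continuous C) (hF : ∀ t, ‖F t‖ ≤ C t * ‖Y t‖) (hY0 : Y 0 = 0) (hV0 : V 0 = 0)
    (t : ℝ) : Y t = 0 := by
  rcases le_total 0 t with ht | ht
  · exact eq_zero_of_norm_second_deriv_le_of_nonneg hY hV hC hF hY0 hV0 ht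
  · have hn : ∀ s : ℝ, HasDerivAt (fun s : ℝ => -s) (-1) s := fun s => (hasDerivAt_id s).neg
    have h := eq_zero_of_norm_second_deriv_le_of_nonneg
      (Y := fun s => Y (-s)) (V := fun s => -V (-s)) (F := fun s => F (-s))
      (C := fun s => C (-s))
      (fun s => by simpa [Function.comp_def] using (hY (-s)).scomp s (hn s))
      (fun s => by
        simpa [Function.comp_def, Pi.neg_def] using ((hV (-s)).scomp s (hn s)).neg)
      (hC.comp continuous_neg) (fun s => hF (-s)) (by simpa using hY0) (by simpa using hV0)
      (neg_nonneg.2 ht)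
    simpa using h

end LinearODE

namespace IsGeodesic

variable {ι : Type*} [Fintype ι] [DecidableEq ι] {A : ℝ → Matrix ι ι ℝ}

/-- The scalar factor in the geodesic equation `A'' = f • A⁻ᵀ`. -/
def factor (A : ℝ → Matrix ι ι ℝ) (t : ℝ) : ℝ :=
  Matrix.trace (deriv A t * (A t)⁻¹ * deriv A t * (A t)⁻¹) /
    Matrix.trace ((A t)⁻¹ * ((A t)⁻¹)ᵀ)

theorem hasDerivAt (h : IsGeodesic A) (t : ℝ) : HasDerivAt A (deriv A t) t :=
  (h.1 t).hasDerivAt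

theorem hasDerivAt_deriv (h : IsGeodesic A) (t : ℝ) :
    HasDerivAt (deriv A) (factor A t • ((A t)⁻¹)ᵀ) t :=
  (h.2.2.2 t) ▸ (h.2.1 t).hasDerivAt

theorem inv_eq_adjugate (h : IsGeodesic A) (t : ℝ) : (A t)⁻¹ = (A t).adjugate := by
  rw [Matrix.inv_def, h.2.2.1 t, Ring.inverse_one, one_smul]

theorem isUnit_det (h : IsGeodesic A) (t : ℝ) : IsUnit (A t).det := by
  rw [h.2.2.1 t]; exact isUnit_one

theorem continuous_inv (h : IsGeodesic A) : Continuous fun t => (A t)⁻¹ := by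
  simp only [h.inv_eq_adjugate]
  exact (continuous_iff_continuousAt.2 fun t => (h.1 t).continuousAt).matrix_adjugate

theorem continuous_factor [Nonempty ι] (h : IsGeodesic A) : Continuous (factor A) := by
  have hA' : Continuous (deriv A) := continuous_iff_continuousAt.2 fun t => (h.2.1 t).continuousAt
  have hI := h.continuous_inv
  refine Continuous.div
    (((((hA'.matrix_mul hI).matrix_mul hA').matrix_mul hI)).matrix_trace)
    ((hI.matrix_mul hI.matrix_transpose).matrix_trace) fun t h0 => ?_
  have hz : (A t)⁻¹ = 0 := by
    rw [← Matrix.conjTranspose_eq_transpose_of_trivial] at h0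
    exact Matrix.trace_mul_conjTranspose_self_eq_zero_iff.1 h0
  have := Matrix.mul_nonsing_inv _ (h.isUnit_det t)
  rw [hz, mul_zero] at this
  exact zero_ne_one this

/-- Conservation of kinetic energy. -/
theorem trace_deriv_transpose_mul_deriv (h : IsGeodesic A) (t : ℝ) :
    ((deriv A t)ᵀ * deriv A t).trace = ((deriv A 0)ᵀ * deriv A 0).trace := by
  have hd : ∀ s, HasDerivAt (fun s => ((deriv A s)ᵀ * deriv A s).trace) 0 s := fun s => by
    have hJ : ((A s)⁻¹ * deriv A s).trace = 0 := by
      rw [h.inv_eq_adjugate]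
      have := (h.hasDerivAt s).matrix_det
      simp only [h.2.2.1] at this
      exact this.unique (hasDerivAt_const s (1 : ℝ))
    have hJ' : ((deriv A s)ᵀ * ((A s)⁻¹)ᵀ).trace = 0 := by
      rw [← Matrix.transpose_mul, Matrix.trace_transpose, hJ]
    have h2 := h.hasDerivAt_deriv s
    refine (h2.matrix_transpose.matrix_mul h2).matrix_trace.congr_deriv ?_
    simp [hJ, hJ']
  exact is_const_of_deriv_eq_zero (fun s => (hd s).differentiableAt) (fun s => (hd s).deriv) t 0

/-- Conservation of the right angular momentum. -/
theorem angularMomentum_eq (h : IsGeodesic A) (t : ℝ) :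
    (A t)ᵀ * deriv A t - (deriv A t)ᵀ * A t = (A 0)ᵀ * deriv A 0 - (deriv A 0)ᵀ * A 0 := by
  have hd : ∀ s, HasDerivAt (fun s => (A s)ᵀ * deriv A s - (deriv A s)ᵀ * A s) 0 s := fun s => by
    have h1 := h.hasDerivAt s
    have h2 := h.hasDerivAt_deriv s
    refine (HasDerivAt.fun_sub (h1.matrix_transpose.matrix_mul h2)
      (h2.matrix_transpose.matrix_mul h1)).congr_deriv ?_
    have hl := Matrix.nonsing_inv_mul _ (h.isUnit_det s)
    have hr : (A s)ᵀ * ((A s)⁻¹)ᵀ = 1 := by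
      rw [← Matrix.transpose_mul, hl, Matrix.transpose_one]
    simp only [Matrix.transpose_smul, Matrix.transpose_transpose, Matrix.mul_smul,
      Matrix.smul_mul, hl, hr]
    abel
  exact is_const_of_deriv_eq_zero (fun s => (hd s).differentiableAt) (fun s => (hd s).deriv) t 0

/-- Isometries `A ↦ U A P⁻¹` fixing the initial data fix the whole geodesic. -/
theorem mul_eq_mul_of_initial [Nonempty ι] (h : IsGeodesic A) {U P : Matrix ι ι ℝ}
    (hU : Uᵀ * U = 1) (hP : P * Pᵀ = 1) (h0 : U * A 0 = A 0 * P)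
    (h0' : U * deriv A 0 = deriv A 0 * P) (t : ℝ) : U * A t = A t * P := by
  set c : ℝ := (Fintype.card ι : ℝ)
  have hkey : ∀ s, U * ((A s)⁻¹)ᵀ - ((A s)⁻¹)ᵀ * P
      = -(((A s)⁻¹)ᵀ * (P * ((U * A s - A s * P)ᵀ * (U * ((A s)⁻¹)ᵀ)))) := fun s => by
    have hl : ((A s)⁻¹)ᵀ * (A s)ᵀ = 1 := by
      rw [← Matrix.transpose_mul, Matrix.mul_nonsing_inv _ (h.isUnit_det s), Matrix.transpose_one]
    have hr : (A s)ᵀ * ((A s)⁻¹)ᵀ = 1 := by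
      rw [← Matrix.transpose_mul, Matrix.nonsing_inv_mul _ (h.isUnit_det s), Matrix.transpose_one]
    set B := ((A s)⁻¹)ᵀ
    rw [Matrix.transpose_sub, Matrix.transpose_mul, Matrix.transpose_mul]
    have e1 : B * (P * ((A s)ᵀ * Uᵀ * (U * B))) = B * P := by
      rw [Matrix.mul_assoc (A s)ᵀ, ← Matrix.mul_assoc Uᵀ, hU, Matrix.one_mul, hr, Matrix.mul_one]
    have e2 : B * (P * (Pᵀ * (A s)ᵀ * (U * B))) = U * B := by
      rw [Matrix.mul_assoc Pᵀ, ← Matrix.mul_assoc P, hP, Matrix.one_mul, ← Matrix.mul_assoc, hl,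
        Matrix.one_mul]
    rw [Matrix.sub_mul, Matrix.mul_sub, Matrix.mul_sub, e1, e2, neg_sub]
  have hI := h.continuous_inv
  refine sub_eq_zero.1 (eq_zero_of_norm_second_deriv_le
    (Y := fun s => U * A s - A s * P) (V := fun s => U * deriv A s - deriv A s * P)
    (F := fun s => factor A s • (U * ((A s)⁻¹)ᵀ - ((A s)⁻¹)ᵀ * P))
    (C := fun s => |factor A s| *
      (c * (‖((A s)⁻¹)ᵀ‖ * (c * (‖P‖ * (c * ‖U * ((A s)⁻¹)ᵀ‖))))))
    (fun s => ?_) (fun s => ?_) ?_ (fun s => ?_) (sub_eq_zero.2 h0) (sub_eq_zero.2 h0') t)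
  · refine (HasDerivAt.fun_sub ((hasDerivAt_const s U).matrix_mul (h.hasDerivAt s))
      ((h.hasDerivAt s).matrix_mul (hasDerivAt_const s P))).congr_deriv ?_
    simp
  · refine (HasDerivAt.fun_sub ((hasDerivAt_const s U).matrix_mul (h.hasDerivAt_deriv s))
      ((h.hasDerivAt_deriv s).matrix_mul (hasDerivAt_const s P))).congr_deriv ?_
    simp [smul_sub]
  · have h1 : Continuous fun s => ‖((A s)⁻¹)ᵀ‖ := hI.matrix_transpose.norm
    have h2 : Continuous fun s => ‖U * ((A s)⁻¹)ᵀ‖ :=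
      (continuous_const.matrix_mul hI.matrix_transpose).norm
    have h3 := h.continuous_factor
    fun_prop
  · rw [norm_smul, Real.norm_eq_abs, mul_assoc]
    refine mul_le_mul_of_nonneg_left ?_ (abs_nonneg _)
    rw [hkey s, norm_neg]
    calc _ ≤ c * (‖((A s)⁻¹)ᵀ‖ * (c * (‖P‖ * (c * (‖(U * A s - A s * P)ᵀ‖ *
          ‖U * ((A s)⁻¹)ᵀ‖))))) := by
          refine (Matrix.norm_mul_le_card_mul _ _).trans ?_
          gcongr
          refine (Matrix.norm_mul_le_card_mul _ _).trans ?_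
          gcongr
          exact Matrix.norm_mul_le_card_mul _ _
      _ = _ := by rw [Matrix.norm_transpose (U * A s - A s * P)]; ring

/-- If the initial data `AᵀA` and `AᵀA'` commute with an orthogonal matrix `P`, then `AᵀA` commutes
with `P` for all time. -/
theorem commute_transpose_mul_self [Nonempty ι] (h : IsGeodesic A) {P : Matrix ι ι ℝ}
    (hP : P * Pᵀ = 1) (h0 : Commute P ((A 0)ᵀ * A 0)) (h0' : Commute P ((A 0)ᵀ * deriv A 0))
    (t : ℝ) : Commute P ((A t)ᵀ * A t) := by
  have hP' : Pᵀ * P = 1 := mul_eq_one_comm.1 hP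
  have hl := Matrix.nonsing_inv_mul _ (h.isUnit_det 0)
  have hr := Matrix.mul_nonsing_inv _ (h.isUnit_det 0)
  have hlt : ((A 0)⁻¹)ᵀ * (A 0)ᵀ = 1 := by rw [← Matrix.transpose_mul, hr, Matrix.transpose_one]
  set B := (A 0)⁻¹
  set U := A 0 * P * B with hUdef
  have hUt : U = Bᵀ * P * (A 0)ᵀ := by
    calc U = (Bᵀ * (A 0)ᵀ) * A 0 * P * B := by rw [hlt, Matrix.one_mul]
      _ = Bᵀ * (((A 0)ᵀ * A 0) * P) * B := by simp only [Matrix.mul_assoc]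
      _ = Bᵀ * (P * ((A 0)ᵀ * A 0)) * B := by rw [h0.eq]
      _ = Bᵀ * P * (A 0)ᵀ * (A 0 * B) := by simp only [Matrix.mul_assoc]
      _ = _ := by rw [hr, Matrix.mul_one]
  have hU : Uᵀ * U = 1 := by
    calc Uᵀ * U = (Bᵀ * P * (A 0)ᵀ)ᵀ * (A 0 * P * B) := by rw [← hUt]
      _ = A 0 * (Pᵀ * ((B * A 0) * (P * B))) := by
        simp only [Matrix.transpose_mul, Matrix.transpose_transpose, Matrix.mul_assoc]
      _ = 1 := by rw [hl, Matrix.one_mul, ← Matrix.mul_assoc Pᵀ, hP', Matrix.one_mul, hr]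
  have hU0 : U * A 0 = A 0 * P := by rw [hUdef, Matrix.mul_assoc, hl, Matrix.mul_one]
  have hU0' : U * deriv A 0 = deriv A 0 * P := by
    calc U * deriv A 0 = Bᵀ * (P * ((A 0)ᵀ * deriv A 0)) := by
          rw [hUt]; simp only [Matrix.mul_assoc]
      _ = Bᵀ * (((A 0)ᵀ * deriv A 0) * P) := by rw [h0'.eq]
      _ = (Bᵀ * (A 0)ᵀ) * deriv A 0 * P := by simp only [Matrix.mul_assoc]
      _ = _ := by rw [hlt, Matrix.one_mul]
  have ht := h.mul_eq_mul_of_initial hU hP hU0 hU0' t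
  have hS : (A t)ᵀ * A t = Pᵀ * ((A t)ᵀ * A t) * P := by
    calc (A t)ᵀ * A t = (A t)ᵀ * (Uᵀ * U) * A t := by rw [hU, Matrix.mul_one]
      _ = (U * A t)ᵀ * (U * A t) := by
        simp only [Matrix.transpose_mul, Matrix.mul_assoc]
      _ = _ := by rw [ht]; simp only [Matrix.transpose_mul, Matrix.mul_assoc]
  change P * ((A t)ᵀ * A t) = (A t)ᵀ * A t * P
  conv_lhs => rw [hS]
  rw [← Matrix.mul_assoc, ← Matrix.mul_assoc, hP, Matrix.one_mul]

end IsGeodesic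

section BlockRotation

variable {m : ℕ}

/-- The block-diagonal matrix rotating the `i`-th block by a quarter turn. -/
def blockRotation (i : Fin m) : Matrix (Fin 2 × Fin m) (Fin 2 × Fin m) ℝ :=
  Matrix.blockDiagonal (Function.update 1 i Z2)

theorem blockRotation_mul_transpose (i : Fin m) :
    blockRotation i * (blockRotation i)ᵀ = 1 := by
  rw [blockRotation, Matrix.blockDiagonal_transpose, ← Matrix.blockDiagonal_mul,
    ← Matrix.blockDiagonal_one]
  congr 1
  funext k
  rcases eq_or_ne k i with rfl | hk
  · ext a b
    fin_cases a <;> fin_cases b <;> simp [Z2, Matrix.mul_apply]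
  · simp [hk]

theorem commute_blockRotation_blockDiagonal (i : Fin m) (a b : Fin m → ℝ) :
    Commute (blockRotation i)
      (Matrix.blockDiagonal fun k => a k • (1 : Matrix (Fin 2) (Fin 2) ℝ) + b k • Z2) := by
  rw [commute_iff_eq, blockRotation, ← Matrix.blockDiagonal_mul, ← Matrix.blockDiagonal_mul]
  congr 1
  funext k
  rcases eq_or_ne k i with rfl | hk
  · simp [mul_add, add_mul]
  · simp [hk]

/-- A symmetric matrix commuting with all block rotations is block-scalar. -/
theorem eq_blockDiagonal_of_commute_blockRotation
    {S : Matrix (Fin 2 × Fin m) (Fin 2 × Fin m) ℝ} (hS : Sᵀ = S)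
    (hc : ∀ i, Commute (blockRotation i) S) :
    S = Matrix.blockDiagonal fun i => S (0, i) (0, i) • (1 : Matrix (Fin 2) (Fin 2) ℝ) := by
  have hl : ∀ i a j b k, (blockRotation i * S) (a, j) (b, k)
      = ∑ c, (Function.update 1 i Z2 : Fin m → Matrix (Fin 2) (Fin 2) ℝ) j a c * S (c, j) (b, k) :=
    fun i a j b k => by
      simp [blockRotation, Matrix.mul_apply, Fintype.sum_prod_type, Matrix.blockDiagonal_apply]
  have hr : ∀ i a j b k, (S * blockRotation i) (a, j) (b, k)
      = ∑ c, S (a, j) (c, k) * (Function.update 1 i Z2 : Fin m → Matrix (Fin 2) (Fin 2) ℝ) k c b :=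
    fun i a j b k => by
      simp [blockRotation, Matrix.mul_apply, Fintype.sum_prod_type, Matrix.blockDiagonal_apply]
  have he : ∀ i a j b k, _ := fun i a j b k =>
    (hl i a j b k).symm.trans ((congrFun (congrFun (hc i).eq (a, j)) (b, k)).trans (hr i a j b k))
  ext ⟨a, j⟩ ⟨b, k⟩
  rw [Matrix.blockDiagonal_apply]
  rcases eq_or_ne j k with rfl | hjk
  · have h01 := he j 0 j 1 j
    have h00 := he j 0 j 0 j
    have hsym : S (1, j) (0, j) = S (0, j) (1, j) := congrFun (congrFun hS (0, j)) (1, j)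
    simp [Z2, Fin.sum_univ_two] at h01 h00
    fin_cases a <;> fin_cases b <;> simp <;> linarith
  · have h0 := fun b => he j 0 j b k
    have h1 := fun b => he j 1 j b k
    simp [Z2, Fin.sum_univ_two, hjk.symm, Matrix.one_apply] at h0 h1
    obtain ⟨h00, h01⟩ := h0
    obtain ⟨h10, h11⟩ := h1
    simp only [hjk, if_false]
    fin_cases a <;> fin_cases b <;> simp <;> linarith

end BlockRotation

theorem sq_transpose_mul_apply_le {ι : Type*} [Fintype ι] (M N : Matrix ι ι ℝ) (p q : ι) :
    ((Mᵀ * N) p q) ^ 2 ≤ (Mᵀ * M) p p * (Nᵀ * N).trace := by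
  have h1 : ((Mᵀ * N) p q) ^ 2 ≤ (Mᵀ * M) p p * (Nᵀ * N) q q := by
    simp only [Matrix.mul_apply, Matrix.transpose_apply]
    simpa only [sq] using Finset.sum_mul_sq_le_sq_mul_sq Finset.univ (M · p) (N · q)
  have hnn : ∀ (X : Matrix ι ι ℝ) r, 0 ≤ (Xᵀ * X) r r := fun X r => by
    simp only [Matrix.mul_apply, Matrix.transpose_apply]
    exact Finset.sum_nonneg fun i _ => mul_self_nonneg _
  refine h1.trans (mul_le_mul_of_nonneg_left ?_ (hnn M p))
  exact Finset.single_le_sum (f := fun r => (Nᵀ * N) r r) (fun r _ => hnn N r) (Finset.mem_univ q)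

theorem le_inv_prod_erase_of_prod_eq_one {ι : Type*} [Fintype ι] [DecidableEq ι] {s d : ι → ℝ}
    (hd : ∀ i, 0 < d i) (hds : ∀ i, d i ≤ s i) (hs : ∏ i, s i = 1) (i : ι) :
    s i ≤ (∏ j ∈ Finset.univ.erase i, d j)⁻¹ := by
  rw [le_inv_comm₀ ((hd i).trans_le (hds i)) (Finset.prod_pos fun j _ => hd j)]
  refine (Finset.prod_le_prod (fun j _ => (hd j).le) fun j _ => hds j).trans_eq ?_
  rw [← Finset.mul_prod_erase _ _ (Finset.mem_univ i)] at hs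
  exact eq_inv_of_mul_eq_one_right hs

/-- a block-diagonal geodesic of `SL(2m)` (with `2×2` blocks) all of
whose angular momenta `zᵢ` are nonzero is bounded. -/
theorem statement_17 {m : ℕ} (hm : 1 ≤ m)
    (A : ℝ → Matrix (Fin 2 × Fin m) (Fin 2 × Fin m) ℝ) (hgeo : IsGeodesic A)
    (lam mu z : Fin m → ℝ) (hz : ∀ i, z i ≠ 0)
    (h₁ : (A 0)ᵀ * A 0 =
      Matrix.blockDiagonal fun i => lam i • (1 : Matrix (Fin 2) (Fin 2) ℝ))
    (h₂ : (A 0)ᵀ * deriv A 0 + (deriv A 0)ᵀ * A 0 =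
      Matrix.blockDiagonal fun i => mu i • (1 : Matrix (Fin 2) (Fin 2) ℝ))
    (h₃ : (A 0)ᵀ * deriv A 0 - (deriv A 0)ᵀ * A 0 =
      Matrix.blockDiagonal fun i => z i • Z2) :
    ∃ R > (0 : ℝ), ∀ t : ℝ, hsNorm (A t) ≤ R := by
  have : Nonempty (Fin 2 × Fin m) := ⟨(0, ⟨0, hm⟩)⟩
  set S : ℝ → Matrix (Fin 2 × Fin m) (Fin 2 × Fin m) ℝ := fun t => (A t)ᵀ * A t with hSdef
  set s : ℝ → Fin m → ℝ := fun t i => S t (0, i) (0, i) with hsdef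
  set E : ℝ := ((deriv A 0)ᵀ * deriv A 0).trace with hE
  have hM : (A 0)ᵀ * deriv A 0 = Matrix.blockDiagonal fun i =>
      (mu i / 2) • (1 : Matrix (Fin 2) (Fin 2) ℝ) + (z i / 2) • Z2 := by
    have h : (A 0)ᵀ * deriv A 0 = (1 / 2 : ℝ) •
        (((A 0)ᵀ * deriv A 0 + (deriv A 0)ᵀ * A 0) +
          ((A 0)ᵀ * deriv A 0 - (deriv A 0)ᵀ * A 0)) := by
      module
    rw [h, h₂, h₃, ← Matrix.blockDiagonal_add, ← Matrix.blockDiagonal_smul]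
    congr 1
    funext i
    simp only [Pi.smul_apply, Pi.add_apply]
    module
  have hS : ∀ t, S t =
      Matrix.blockDiagonal fun i => s t i • (1 : Matrix (Fin 2) (Fin 2) ℝ) := fun t => by
    refine eq_blockDiagonal_of_commute_blockRotation (by simp [hSdef]) fun i => ?_
    refine hgeo.commute_transpose_mul_self (blockRotation_mul_transpose i) ?_ ?_ t
    · rw [h₁]
      simpa using commute_blockRotation_blockDiagonal i lam 0
    · rw [hM]
      exact commute_blockRotation_blockDiagonal i _ _
  have hs0 : ∀ t i, 0 ≤ s t i := fun t i => by
    simp only [hsdef, hSdef, Matrix.mul_apply, Matrix.transpose_apply]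
    exact Finset.sum_nonneg fun _ _ => mul_self_nonneg _
  have hprod : ∀ t, ∏ i, s t i = 1 := fun t => by
    have h : (S t).det = 1 := by simp [hSdef, hgeo.2.2.1 t]
    rw [hS t, Matrix.det_blockDiagonal] at h
    simp only [Matrix.det_smul, Matrix.det_one, mul_one, Fintype.card_fin, Finset.prod_pow] at h
    exact (pow_eq_one_iff_of_nonneg (Finset.prod_nonneg fun i _ => hs0 t i) two_ne_zero).1 h
  have hlow : ∀ t i, z i ^ 2 ≤ 4 * (s t i * E) := fun t i => by
    have hW := congrFun (congrFun ((hgeo.angularMomentum_eq t).trans h₃) (0, i)) (1, i)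
    have hx := sq_transpose_mul_apply_le (A t) (deriv A t) (0, i) (1, i)
    have hy := sq_transpose_mul_apply_le (A t) (deriv A t) (1, i) (0, i)
    have hs1 : S t (1, i) (1, i) = s t i := by rw [hS t]; simp
    have hT : ((deriv A t)ᵀ * A t) (0, i) (1, i) = ((A t)ᵀ * deriv A t) (1, i) (0, i) := by
      simp only [Matrix.mul_apply, Matrix.transpose_apply, mul_comm]
    rw [hgeo.trace_deriv_transpose_mul_deriv t] at hx hy
    rw [Matrix.sub_apply, hT, Matrix.blockDiagonal_apply] at hW
    simp [Z2] at hW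
    change _ ≤ s t i * E at hx
    change _ ≤ S t (1, i) (1, i) * E at hy
    rw [hs1] at hy
    rw [← neg_sq, ← hW]
    nlinarith [sq_nonneg (((A t)ᵀ * deriv A t) (0, i) (1, i) +
      ((A t)ᵀ * deriv A t) (1, i) (0, i))]
  have hEpos : 0 < E := by
    have h := hlow 0 ⟨0, hm⟩
    have hz0 := sq_pos_of_ne_zero (hz ⟨0, hm⟩)
    by_contra! hneg
    nlinarith [mul_nonneg (hs0 0 ⟨0, hm⟩) (neg_nonneg.2 hneg)]
  set d : Fin m → ℝ := fun i => z i ^ 2 / (4 * E) with hd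
  have hdpos : ∀ i, 0 < d i := fun i => by
    have := sq_pos_of_ne_zero (hz i)
    positivity
  have hds : ∀ t i, d i ≤ s t i := fun t i => by
    rw [hd, div_le_iff₀ (by positivity)]
    linarith [hlow t i]
  set T : ℝ := ∑ i, 2 * (∏ j ∈ Finset.univ.erase i, d j)⁻¹ with hT
  refine ⟨Real.sqrt T + 1, by positivity, fun t => ?_⟩
  have htr : (A t * (A t)ᵀ).trace = ∑ i, 2 * s t i := by
    rw [Matrix.trace_mul_comm]
    change (S t).trace = _
    rw [hS t, Matrix.trace_blockDiagonal]
    refine Finset.sum_congr rfl fun i _ => ?_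
    simp [mul_comm]
  have hle : hsNorm (A t) ≤ Real.sqrt T := by
    rw [hsNorm, htr]
    refine Real.sqrt_le_sqrt (Finset.sum_le_sum fun i _ => ?_)
    have := le_inv_prod_erase_of_prod_eq_one hdpos (hds t) (hprod t) i
    linarith
  linarith
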